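/- arXiv:1102.2700 — 8 statements merged into one kernel-verified Lean document; each statement's English description precedes it below -/
import Mathlib

section
/- For every (n,k) unit memory code over F = GF(q^s), i.e., a memory-1 convolutional code whose generator submatrices G_0 and G_1 both have rank k, the free rank distance is upper bounded by d_free ≤ 2n − k + 1. -/
open Matrix

/-- The rank norm of a vector `v ∈ F^n`. -/
noncomputable def rankq (Fq : Type*) {F : Type*} [Field Fq] [Field F] [Algebra Fq F]
    {n : ℕ} (v : Fin n → F) : ℕ :=
  Module.finrank Fq (Submodule.span Fq (Set.range v))

/-- Codeword sequence of a memory-1 convolutional code. -/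
noncomputable def cw {F : Type*} [Field F] {k n : ℕ} (G0 G1 : Matrix (Fin k) (Fin n) F)
    (u : ℕ → Fin k → F) : ℕ → Fin n → F :=
  fun j => u j ᵥ* G0 + (if j = 0 then 0 else u (j - 1) ᵥ* G1)

/-- A vector vanishing on a finite set of coordinates has rank norm at most the number of the
remaining coordinates. -/
theorem rankq_le_of_vanishing (Fq : Type*) {F : Type*} [Field Fq] [Field F] [Algebra Fq F]
    {n : ℕ} (v : Fin n → F) (S : Finset (Fin n)) (hS : ∀ i ∈ S, v i = 0) :
    rankq Fq v ≤ n - S.card := by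
  classical
  have hspan : Submodule.span Fq (Set.range v) ≤
      Submodule.span Fq (((Sᶜ).image v : Finset F) : Set F) := by
    rw [Submodule.span_le]
    rintro _ ⟨i, rfl⟩
    by_cases hi : i ∈ S
    · rw [hS i hi]
      exact Submodule.zero_mem _
    · exact Submodule.subset_span (by simpa using ⟨i, hi, rfl⟩)
  calc rankq Fq v
      ≤ Module.finrank Fq (Submodule.span Fq (((Sᶜ).image v : Finset F) : Set F)) :=
        Submodule.finrank_mono hspan
    _ ≤ ((Sᶜ).image v).card := finrank_span_finset_le_card _
    _ ≤ (Sᶜ).card := Finset.card_image_le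
    _ = n - S.card := by rw [Finset.card_compl, Fintype.card_fin]

/-- Some nonzero information block is encoded into a block with at least `k - 1` zeros. -/
theorem exists_ne_zero_vecMul_vanishing {F : Type*} [Field F] {k n : ℕ} (hk : 1 ≤ k)
    (G : Matrix (Fin k) (Fin n) F) (S : Finset (Fin n)) (hS : S.card = k - 1) :
    ∃ x : Fin k → F, x ≠ 0 ∧ ∀ i ∈ S, (x ᵥ* G) i = 0 := by
  let f : (Fin k → F) →ₗ[F] (S → F) :=
    (LinearMap.funLeft F F (Subtype.val : S → Fin n)).comp G.vecMulLinear
  have hker : LinearMap.ker f ≠ ⊥ := by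
    apply LinearMap.ker_ne_bot_of_finrank_lt
    simp only [Module.finrank_fintype_fun_eq_card, Fintype.card_coe, Fintype.card_fin, hS]
    omega
  obtain ⟨x, hx, hx0⟩ := (Submodule.ne_bot_iff _).mp hker
  exact ⟨x, hx0, fun i hi => congrFun (LinearMap.mem_ker.mp hx) ⟨i, hi⟩⟩

/-- Upper bound on the free rank distance of an `(n,k)` unit memory code:
`d_free ≤ 2n - k + 1`. -/
theorem unit_memory_free_rank_distance_upper_bound
    (Fq F : Type*) [Field Fq] [Fintype Fq] [Field F] [Algebra Fq F]
    [FiniteDimensional Fq F] (n k : ℕ) (hk : 1 ≤ k) (hkn : k < n)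
    (G0 G1 : Matrix (Fin k) (Fin n) F) (hG0 : G0.rank = k) (hG1 : G1.rank = k) :
    sInf {w : ℕ | ∃ u : ℕ → Fin k → F, (∃ N, ∀ i, N ≤ i → u i = 0) ∧
        cw G0 G1 u ≠ 0 ∧ w = ∑ᶠ j, rankq Fq (cw G0 G1 u j)} ≤ 2 * n - k + 1 := by
  obtain ⟨S, -, hS⟩ := Finset.exists_subset_card_eq
    (show k - 1 ≤ (Finset.univ : Finset (Fin n)).card by rw [Finset.card_fin]; omega)
  obtain ⟨x, hx0, hx⟩ := exists_ne_zero_vecMul_vanishing hk G0 S hS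
  have hrow : LinearIndependent F G0.row := by
    rw [linearIndependent_iff_card_eq_finrank_span, Fintype.card_fin, Set.finrank,
      ← Matrix.rank_eq_finrank_span_row, hG0]
  have hinj : Function.Injective G0.vecMul := Matrix.vecMul_injective_iff.mpr hrow
  let u : ℕ → Fin k → F := fun j => if j = 0 then x else 0
  have hc0 : cw G0 G1 u 0 = x ᵥ* G0 := by simp [cw, u]
  have hc : ∀ j, 2 ≤ j → cw G0 G1 u j = 0 := by
    intro j hj
    have h1 : j ≠ 0 := by omega
    have h2 : j - 1 ≠ 0 := by omega
    simp [cw, u, h1, h2]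
  have hsum : ∑ᶠ j, rankq Fq (cw G0 G1 u j) =
      rankq Fq (cw G0 G1 u 0) + rankq Fq (cw G0 G1 u 1) := by
    rw [finsum_eq_sum_of_support_subset (s := Finset.range 2), Finset.sum_range_succ,
      Finset.sum_range_one]
    intro j hj
    by_contra hj2
    have hj2 : 2 ≤ j := by simpa [Nat.succ_le_iff] using hj2
    apply hj
    have := rankq_le_of_vanishing Fq (cw G0 G1 u j) Finset.univ (by simp [hc j hj2])
    simpa using this
  have h0 := rankq_le_of_vanishing Fq (cw G0 G1 u 0) S (by rw [hc0]; exact hx)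
  have h1 := rankq_le_of_vanishing Fq (cw G0 G1 u 1) ∅ (by simp)
  have hne : cw G0 G1 u ≠ 0 := by
    intro h
    apply hx0
    apply hinj
    change x ᵥ* G0 = 0 ᵥ* G0
    rw [← hc0, h, Matrix.zero_vecMul, Pi.zero_apply]
  refine le_trans (Nat.sInf_le (Set.mem_ofPred.mpr
    ⟨u, ⟨1, fun i hi => if_neg (by omega)⟩, hne, rfl⟩)) ?_
  rw [hsum]
  rw [hS] at h0
  rw [Finset.card_empty] at h1
  omega
end

section
/- For every (n, k | k_1) partial unit memory code over F = GF(q^s), i.e., a memory-1 convolutional code whose generator submatrix G_0 has rank k and whose generator submatrix G_1 has rank k_1 < k with its last k − k_1 rows equal to zero, the free rank distance is upper bounded by d_free ≤ n − k + k_1 + 1 (here the overall constraint length is ν = k_1). -/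
open Matrix

/-- The rank norm is at most the length minus the number of a set of vanishing coordinates. -/
theorem rankq_le_sub_card (Fq : Type*) {F : Type*} [Field Fq] [Field F] [Algebra Fq F]
    {n : ℕ} (v : Fin n → F) (s : Finset (Fin n)) (hs : ∀ i ∈ s, v i = 0) :
    rankq Fq v ≤ n - s.card := by
  classical
  have hspan : Submodule.span Fq (Set.range v) =
      Submodule.span Fq ((sᶜ.image v : Finset F) : Set F) := by
    refine le_antisymm (Submodule.span_le.2 ?_) (Submodule.span_mono ?_)
    · rintro _ ⟨i, rfl⟩
      by_cases hi : i ∈ s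
      · simp [hs i hi]
      · exact Submodule.subset_span (by simpa using ⟨i, hi, rfl⟩)
    · intro x hx
      obtain ⟨i, -, rfl⟩ := Finset.mem_image.1 (Finset.mem_coe.1 hx)
      exact ⟨i, rfl⟩
  rw [rankq, hspan]
  calc _ ≤ (sᶜ.image v).card := finrank_span_finset_le_card _
    _ ≤ sᶜ.card := Finset.card_image_le
    _ = n - s.card := by rw [Finset.card_compl, Fintype.card_fin]

theorem vecMul_injective_of_rank_eq {F : Type*} [Field F] {k n : ℕ}
    {G : Matrix (Fin k) (Fin n) F} (hG : G.rank = k) :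
    Function.Injective fun x : Fin k → F => x ᵥ* G := by
  rw [Matrix.vecMul_injective_iff, linearIndependent_iff_card_eq_finrank_span,
    Set.finrank, ← Matrix.rank_eq_finrank_span_row, hG, Fintype.card_fin]

/-- Some nonzero information block vanishes on the first `k₁` coordinates while its encoding
vanishes on the coordinates from `k₁` up to `k - 1`. -/
theorem exists_ne_zero_vecMul_eq_zero {F : Type*} [Field F] {k n k₁ : ℕ} (hk : 1 ≤ k)
    (hkn : k < n) (G : Matrix (Fin k) (Fin n) F) :
    ∃ x : Fin k → F, x ≠ 0 ∧ (∀ i : Fin k, (i : ℕ) < k₁ → (i : ℕ) < k - 1 → x i = 0) ∧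
      ∀ i : Fin n, k₁ ≤ (i : ℕ) → (i : ℕ) < k - 1 → (x ᵥ* G) i = 0 := by
  let L : (Fin k → F) →ₗ[F] (Fin (k - 1) → F) := LinearMap.pi fun i =>
    if (i : ℕ) < k₁ then LinearMap.proj ⟨i, by omega⟩
    else LinearMap.proj ⟨i, by omega⟩ ∘ₗ G.vecMulLinear
  have hL : LinearMap.ker L ≠ ⊥ := LinearMap.ker_ne_bot_of_finrank_lt (by simp; omega)
  obtain ⟨x, hx, hx0⟩ := (Submodule.ne_bot_iff _).1 hL
  refine ⟨x, hx0, fun i hi hik => ?_, fun i hi hik => ?_⟩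
  · simpa [L, hi] using congrFun (LinearMap.mem_ker.1 hx) ⟨i, hik⟩
  · simpa [L, hi.not_gt] using congrFun (LinearMap.mem_ker.1 hx) ⟨i, hik⟩

/-- Upper bound on the free rank distance of an `(n, k | k₁)` partial unit memory code:
`d_free ≤ n - k + k₁ + 1`. -/
theorem partial_unit_memory_free_rank_distance_upper_bound
    (Fq F : Type*) [Field Fq] [Fintype Fq] [Field F] [Algebra Fq F]
    [FiniteDimensional Fq F] (n k k₁ : ℕ) (hk : 1 ≤ k) (hkn : k < n) (hk₁ : k₁ < k)
    (G0 G1 : Matrix (Fin k) (Fin n) F) (hG0 : G0.rank = k) (hG1 : G1.rank = k₁)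
    (hG1zero : ∀ i : Fin k, k₁ ≤ (i : ℕ) → G1 i = 0) :
    sInf {w : ℕ | ∃ u : ℕ → Fin k → F, (∃ N, ∀ i, N ≤ i → u i = 0) ∧
        cw G0 G1 u ≠ 0 ∧ w = ∑ᶠ j, rankq Fq (cw G0 G1 u j)} ≤ n - k + k₁ + 1 := by
  obtain ⟨x, hx0, hx1, hx2⟩ := exists_ne_zero_vecMul_eq_zero (k₁ := k₁) hk hkn G0
  have hxG1 : x ᵥ* G1 = 0 := by
    ext j
    rw [Matrix.vecMul, dotProduct]
    refine Finset.sum_eq_zero fun i _ => ?_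
    rcases lt_or_ge (i : ℕ) k₁ with hi | hi
    · simp [hx1 i hi (by omega)]
    · simp [hG1zero i hi]
  have hxG0 : x ᵥ* G0 ≠ 0 := fun h =>
    hx0 (vecMul_injective_of_rank_eq hG0 (by simpa using h))
  have hcw : cw G0 G1 (Pi.single 0 x) = Pi.single 0 (x ᵥ* G0) := by
    funext j
    rcases j with _ | _ | j
    · simp [cw]
    · simp [cw, hxG1]
    · simp [cw]
  have hsum : ∑ᶠ j, rankq Fq (cw G0 G1 (Pi.single 0 x) j) = rankq Fq (x ᵥ* G0) := by
    rw [finsum_eq_single _ 0]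
    · simp [hcw]
    · intro j hj
      simp [hcw, hj, rankq]
  have hle : rankq Fq (x ᵥ* G0) ≤ n - (k - 1 - k₁) := by
    have h := rankq_le_sub_card Fq (x ᵥ* G0)
      (Finset.Ico (⟨k₁, by omega⟩ : Fin n) ⟨k - 1, by omega⟩) fun i hi =>
        hx2 i (Fin.le_def.1 (Finset.mem_Ico.1 hi).1) (Fin.lt_def.1 (Finset.mem_Ico.1 hi).2)
    simpa using h
  refine le_trans (Nat.sInf_le ⟨Pi.single 0 x, ⟨1, fun i hi => ?_⟩, ?_, rfl⟩) ?_
  · have hi0 : i ≠ 0 := by omega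
    simp [hi0]
  · simpa [hcw] using hxG0
  · rw [hsum]
    omega
end

section
/- Let q be a prime power, F = GF(q^s), and let h = (h_1, …, h_n) ∈ F^n have entries linearly independent over GF(q). Let 1 ≤ r < n. Then every nonzero c ∈ F^n satisfying V_r(h)·c^T = 0 has rank norm rank_q(c) ≥ r + 1. (In particular, the (n, n−r) Gabidulin code with parity-check matrix V_r(h) has minimum rank distance at least n − k + 1 where k = n − r.) -/
open Matrix

theorem frobeniusAlgHom_pow_apply (K : Type*) {F : Type*} [Field K] [Fintype K] [Field F]
    [Algebra K F] (i : ℕ) (x : F) :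
    (FiniteField.frobeniusAlgHom K F ^ i) x = x ^ Fintype.card K ^ i := by
  rw [AlgHom.coe_pow, FiniteField.coe_frobeniusAlgHom, pow_iterate]

/-- The square Moore matrix of a linearly independent family over a finite field is nonsingular. -/
theorem det_moore_ne_zero {K F : Type*} [Field K] [Fintype K] [Field F] [Algebra K F]
    {d : ℕ} {g : Fin d → F} (hg : LinearIndependent K g) :
    (Matrix.of fun (i j : Fin d) => g j ^ Fintype.card K ^ (i : ℕ)).det ≠ 0 := by
  classical
  intro hdet
  obtain ⟨v, hv, hvM⟩ := Matrix.exists_vecMul_eq_zero_iff.mpr hdet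
  have hq : 1 < Fintype.card K := Fintype.one_lt_card
  let φ : F →ₗ[K] F := ∑ i : Fin d,
    v i • (FiniteField.frobeniusAlgHom K F ^ (i : ℕ)).toLinearMap
  have hφ (x : F) : φ x = ∑ i : Fin d, v i * x ^ Fintype.card K ^ (i : ℕ) := by
    simp [φ, frobeniusAlgHom_pow_apply, -AlgHom.coe_pow]
  let p : Polynomial F := ∑ i : Fin d,
    Polynomial.C (v i) * Polynomial.X ^ Fintype.card K ^ (i : ℕ)
  have hspan : Submodule.span K (Set.range g) ≤ LinearMap.ker φ := by
    rw [Submodule.span_le]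
    rintro _ ⟨t, rfl⟩
    have ht := congrFun hvM t
    simpa [hφ, Matrix.vecMul, dotProduct] using ht
  have : FiniteDimensional K (Submodule.span K (Set.range g)) :=
    FiniteDimensional.span_of_finite K (Set.finite_range g)
  have : Finite (Submodule.span K (Set.range g)) := Module.finite_of_finite K
  have : Fintype (Submodule.span K (Set.range g)) := Fintype.ofFinite _
  have hcard : Fintype.card (Submodule.span K (Set.range g)) = Fintype.card K ^ d := by
    rw [Module.card_eq_pow_finrank (K := K), finrank_span_eq_card hg, Fintype.card_fin]
  have hdeg : p.natDegree < Fintype.card K ^ d := by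
    refine lt_of_le_of_lt (Polynomial.natDegree_sum_le_of_forall_le (n := Fintype.card K ^ (d - 1))
      _ _ fun i _ => ?_) (Nat.pow_lt_pow_right hq ?_)
    · exact (Polynomial.natDegree_C_mul_X_pow_le _ _).trans
        (Nat.pow_le_pow_right hq.le (by omega))
    · have : d ≠ 0 := by
        rintro rfl
        exact hv (Subsingleton.elim _ _)
      omega
  have hp : p = 0 := by
    refine Polynomial.eq_zero_of_natDegree_lt_card_of_eval_eq_zero p
      (f := ((↑) : Submodule.span K (Set.range g) → F)) Subtype.val_injective (fun x => ?_)
      (hcard ▸ hdeg)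
    have hx : φ x = 0 := hspan x.2
    simpa [p, Polynomial.eval_finsetSum, hφ] using hx
  apply hv
  funext i
  have hi := congrArg (Polynomial.coeff · (Fintype.card K ^ (i : ℕ))) hp
  simpa [p, Polynomial.finsetSum_coeff, Polynomial.coeff_X_pow,
    (Nat.pow_right_injective hq).eq_iff, Fin.val_inj] using hi

/-- Expanding a vector in a basis of the span of its entries and pairing the coordinates with a
linearly independent family gives a linearly independent family. -/
theorem linearIndependent_sum_coord_smul {K V W ι κ : Type*} [Field K] [AddCommGroup V]
    [Module K V] [AddCommGroup W] [Module K W] [Fintype ι] [Fintype κ] {h : ι → W}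
    (hh : LinearIndependent K h) (c : ι → V)
    (b : Module.Basis κ K (Submodule.span K (Set.range c))) :
    LinearIndependent K fun t : κ =>
      ∑ j, b.repr ⟨c j, Submodule.subset_span ⟨j, rfl⟩⟩ t • h j := by
  classical
  rw [Fintype.linearIndependent_iff] at hh ⊢
  intro μ hμ
  have hcoord := hh
    (fun j => ∑ t, μ t * b.repr ⟨c j, Submodule.subset_span ⟨j, rfl⟩⟩ t) (by
      rw [← hμ]
      simp only [Finset.sum_smul, Finset.smul_sum, mul_smul]
      exact Finset.sum_comm)
  let f : Submodule.span K (Set.range c) →ₗ[K] K := ∑ t, μ t • b.coord t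
  have hf : f = 0 := by
    refine LinearMap.ext_on_range (v := fun j => ⟨c j, Submodule.subset_span ⟨j, rfl⟩⟩) ?_ ?_
    · exact Submodule.span_range_subtype_eq_top_iff _ _ |>.mpr rfl
    · intro j
      simpa [f] using hcoord j
  intro t
  have ht := LinearMap.congr_fun hf (b t)
  simpa [f, Finsupp.single_apply] using ht

/-- Every nonzero codeword of the `(n, n-r)` Gabidulin code with parity-check matrix
`V_r(h)` has rank norm at least `r + 1` (the code is MRD). -/
theorem gabidulin_min_rank_distance
    (Fq F : Type*) [Field Fq] [Fintype Fq] [Field F] [Algebra Fq F]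
    [FiniteDimensional Fq F] (n r : ℕ) (hr : 1 ≤ r) (hrn : r < n)
    (h : Fin n → F) (hli : LinearIndependent Fq h)
    (c : Fin n → F) (hc : c ≠ 0)
    (hsyn : (Matrix.of fun (i : Fin r) (j : Fin n) =>
        h j ^ Fintype.card Fq ^ (i : ℕ)).mulVec c = 0) :
    r + 1 ≤ rankq Fq c := by
  by_contra! hlt
  have hdr : rankq Fq c ≤ r := by omega
  let b : Module.Basis (Fin (rankq Fq c)) Fq (Submodule.span Fq (Set.range c)) :=
    Module.finBasis Fq (Submodule.span Fq (Set.range c))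
  have hcb (j : Fin n) : c j =
      ∑ t, b.repr ⟨c j, Submodule.subset_span ⟨j, rfl⟩⟩ t • (b t : F) := by
    have := congrArg Subtype.val (b.sum_repr ⟨c j, Submodule.subset_span ⟨j, rfl⟩⟩)
    rw [Submodule.coe_sum] at this
    exact this.symm
  have hdet := det_moore_ne_zero (linearIndependent_sum_coord_smul hli c b)
  have hb := Matrix.eq_zero_of_mulVec_eq_zero hdet (v := fun t => (b t : F)) (by
    funext i
    have hi : ∑ j, h j ^ Fintype.card Fq ^ (i : ℕ) * c j = 0 :=
      congrFun hsyn (Fin.castLE hdr i)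
    have hfrob (x : F) : x ^ Fintype.card Fq ^ (i : ℕ) =
        (FiniteField.frobeniusAlgHom Fq F ^ (i : ℕ)) x := by
      rw [frobeniusAlgHom_pow_apply]
    simp only [Matrix.mulVec, dotProduct, Matrix.of_apply, Pi.zero_apply]
    rw [← hi]
    simp only [hfrob, map_sum, map_smul, Finset.sum_mul]
    rw [Finset.sum_comm]
    refine Finset.sum_congr rfl fun j _ => ?_
    conv_rhs => rw [hcb j]
    simp only [Finset.mul_sum, smul_mul_assoc, mul_smul_comm])
  apply hc
  funext j
  rw [hcb j]
  refine Finset.sum_eq_zero fun t _ => ?_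
  rw [show (b t : F) = 0 from congrFun hb t, smul_zero]
end

section
/- Singleton bound for the rank metric: let q be a prime power, F = GF(q^s), and let C ⊆ F^n be an F-linear subspace with dim_F C = k ≥ 1. Then C contains a nonzero vector c with rank norm rank_q(c) ≤ n − k + 1. Hence the minimum rank distance of any linear (n,k) code over F is at most n − k + 1. -/
open Matrix

/-- The rank norm of a vector is at most its Hamming weight. -/
theorem rankq_le_hammingNorm (Fq : Type*) {F : Type*} [Field Fq] [Field F] [Algebra Fq F]
    [DecidableEq F] {n : ℕ} (v : Fin n → F) : rankq Fq v ≤ hammingNorm v := by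
  let s : Finset F := (Finset.univ.filter fun i => v i ≠ 0).image v
  have hle : Submodule.span Fq (Set.range v) ≤ Submodule.span Fq (s : Set F) := by
    rw [Submodule.span_le]
    rintro _ ⟨i, rfl⟩
    by_cases hi : v i = 0
    · rw [hi]
      exact Submodule.zero_mem _
    · exact Submodule.subset_span
        (Finset.mem_coe.2 (Finset.mem_image_of_mem v (by simpa using hi)))
  calc rankq Fq v ≤ Module.finrank Fq (Submodule.span Fq (s : Set F)) :=
        Submodule.finrank_mono hle
    _ ≤ s.card := finrank_span_finset_le_card s
    _ ≤ hammingNorm v := Finset.card_image_le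

/-- A linear code contains a nonzero codeword vanishing on any prescribed set of fewer
coordinates than its dimension. -/
theorem Submodule.exists_ne_zero_forall_eq_zero {F ι : Type*} [Field F] [Finite ι]
    (C : Submodule F (ι → F)) (s : Finset ι) (hs : s.card < Module.finrank F C) :
    ∃ c ∈ C, c ≠ 0 ∧ ∀ i ∈ s, c i = 0 := by
  let f : C →ₗ[F] (s → F) := (LinearMap.funLeft F F ((↑) : s → ι)).comp C.subtype
  have hker : LinearMap.ker f ≠ ⊥ := LinearMap.ker_ne_bot_of_finrank_lt (by simpa using hs)
  obtain ⟨c, hc, hc0⟩ := Submodule.exists_mem_ne_zero_of_ne_bot hker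
  exact ⟨c, c.2, by simpa using hc0, fun i hi => congrFun (LinearMap.mem_ker.1 hc) ⟨i, hi⟩⟩

/-- Singleton bound for the rank metric: any `F`-linear code `C ⊆ F^n` of dimension
`k ≥ 1` contains a nonzero codeword of rank norm at most `n - k + 1`. -/
theorem singleton_bound_rank_metric
    (Fq F : Type*) [Field Fq] [Fintype Fq] [Field F] [Algebra Fq F]
    [FiniteDimensional Fq F] (n k : ℕ) (hk : 1 ≤ k)
    (C : Submodule F (Fin n → F)) (hC : Module.finrank F C = k) :
    ∃ c ∈ C, c ≠ 0 ∧ rankq Fq c ≤ n - k + 1 := by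
  classical
  have hkn : k ≤ n := by simpa [hC] using C.finrank_le
  obtain ⟨s, -, hs⟩ := Finset.exists_subset_card_eq (s := (Finset.univ : Finset (Fin n)))
    (n := k - 1) (by simp; omega)
  obtain ⟨c, hcC, hc0, hc⟩ := C.exists_ne_zero_forall_eq_zero s (by omega)
  refine ⟨c, hcC, hc0, (rankq_le_hammingNorm Fq c).trans ?_⟩
  have hsub : (Finset.univ.filter fun i => c i ≠ 0) ⊆ sᶜ := fun i hi =>
    Finset.mem_compl.2 fun his => (Finset.mem_filter.1 hi).2 (hc i his)
  calc hammingNorm c ≤ sᶜ.card := Finset.card_le_card hsub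
    _ = n - (k - 1) := by rw [Finset.card_compl, Fintype.card_fin, hs]
    _ ≤ n - k + 1 := by omega
end

section
/- Let q be a prime power, F = GF(q^s), let b ∈ F be a normal element (so that b, b^q, …, b^{q^{s−1}} form a basis of F over GF(q)), let 1 ≤ k < n, r = n − k, m_H ≥ 1, and suppose s ≥ (m_H + 1)·⌈n/r⌉·r. For 0 ≤ j ≤ n−1 define the exponent e(j) = ⌊j/r⌋·(m_H+1)·r + (j mod r). Then the (m_H + 1)·n field elements b^{q^{e(j) + i·r}}, for 0 ≤ j ≤ n−1 and 0 ≤ i ≤ m_H, are linearly independent over GF(q). (Hence the vector h^{(0)} with entries b^{q^{e(j)}} and its Frobenius shifts h^{(i)} = (h^{(0)})^{q^{i·r}} satisfy the linear-independence requirements of the (P)UM construction based on Gabidulin codes.) -/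
/-- The exponent is the mixed-radix number with digits `j / r`, `i`, `j % r`. -/
theorem interleaved_exponent_eq (r M i j : ℕ) :
    j / r * (M * r) + j % r + i * r = j % r + r * (i + M * (j / r)) := by
  ring

theorem interleaved_exponent_lt {r M c i j : ℕ} (hr : 0 < r) (hi : i < M) (hj : j / r < c) :
    j / r * (M * r) + j % r + i * r < M * c * r := by
  have hmod := Nat.mod_lt j hr
  have hdigit : i + M * (j / r) + 1 ≤ M * c := by
    have := Nat.mul_le_mul_left M (Nat.succ_le_of_lt hj)
    rw [Nat.mul_succ] at this
    omega
  have := Nat.mul_le_mul_left r hdigit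
  rw [interleaved_exponent_eq, Nat.mul_comm (M * c) r]
  rw [Nat.mul_succ] at this
  omega

theorem interleaved_exponent_inj {r M i i' j j' : ℕ} (hr : 0 < r) (hi : i < M) (hi' : i' < M)
    (h : j / r * (M * r) + j % r + i * r = j' / r * (M * r) + j' % r + i' * r) :
    i = i' ∧ j = j' := by
  rw [interleaved_exponent_eq, interleaved_exponent_eq] at h
  have hmod : j % r = j' % r := by
    simpa [Nat.add_mul_mod_self_left] using congrArg (· % r) h
  have hquot : i + M * (j / r) = i' + M * (j' / r) := by
    rw [hmod] at h
    exact Nat.eq_of_mul_eq_mul_left hr (Nat.add_left_cancel h)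
  have hii : i = i' := by
    simpa [Nat.add_mul_mod_self_left, Nat.mod_eq_of_lt hi, Nat.mod_eq_of_lt hi'] using
      congrArg (· % M) hquot
  have hdiv : j / r = j' / r := by
    rw [hii] at hquot
    exact Nat.eq_of_mul_eq_mul_left (Nat.zero_lt_of_lt hi) (Nat.add_left_cancel hquot)
  refine ⟨hii, ?_⟩
  rw [← Nat.div_add_mod j r, ← Nat.div_add_mod j' r, hdiv, hmod]

/-- The `(m_H+1)·n` Frobenius powers of a normal element used in the (P)UM construction
based on Gabidulin codes are linearly independent over `GF(q)`. Here `r = n - k`,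
`e(j) = ⌊j/r⌋·(m_H+1)·r + (j mod r)`, and the elements are `b^(q^(e(j) + i·r))`
for `0 ≤ j ≤ n-1`, `0 ≤ i ≤ m_H`. -/
theorem normal_basis_pum_construction_linearIndependent
    (Fq F : Type*) [Field Fq] [Fintype Fq] [Field F] [Algebra Fq F]
    [FiniteDimensional Fq F] (s n k mH : ℕ)
    (hs : Module.finrank Fq F = s)
    (hk : 1 ≤ k) (hkn : k < n) (hmH : 1 ≤ mH)
    (hsize : (mH + 1) * ((n + (n - k) - 1) / (n - k)) * (n - k) ≤ s)
    (b : F)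
    (hbli : LinearIndependent Fq (fun i : Fin s => b ^ Fintype.card Fq ^ (i : ℕ)))
    (hbspan : Submodule.span Fq (Set.range fun i : Fin s => b ^ Fintype.card Fq ^ (i : ℕ)) = ⊤) :
    LinearIndependent Fq (fun p : Fin (mH + 1) × Fin n =>
      b ^ Fintype.card Fq ^
        (((p.2 : ℕ) / (n - k)) * ((mH + 1) * (n - k)) + (p.2 : ℕ) % (n - k)
          + (p.1 : ℕ) * (n - k))) := by
  have hr : 0 < n - k := Nat.sub_pos_of_lt hkn
  have hlt (p : Fin (mH + 1) × Fin n) :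
      ((p.2 : ℕ) / (n - k)) * ((mH + 1) * (n - k)) + (p.2 : ℕ) % (n - k)
        + (p.1 : ℕ) * (n - k) < s := by
    refine (interleaved_exponent_lt hr p.1.isLt ?_).trans_le hsize
    rw [← Nat.succ_le_iff, Nat.succ_eq_add_one, ← Nat.add_div_right _ hr]
    exact Nat.div_le_div_right (by omega)
  refine hbli.comp (fun p => ⟨_, hlt p⟩) fun p p' h => ?_
  obtain ⟨h₁, h₂⟩ := interleaved_exponent_inj hr p.1.isLt p'.1.isLt (Fin.mk.inj h)
  exact Prod.ext (Fin.ext h₁) (Fin.ext h₂)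
end

section
/- For the PUM code based on Gabidulin codes with dual memory m_H = 1 and rate R > 1/2 (i.e., 2k > n), the first extended row rank distance equals d^r_1 = 2(n − k) + 1; that is, the minimum of rank_q(c) over nonzero c ∈ F^n satisfying both H_0·c^T = 0 and H_1·c^T = 0 equals 2(n − k) + 1. -/
open Matrix

/-- The `r × n` Moore (Frobenius) matrix `V_r(h)` with `(i,j)` entry `h_j^(q^i)`. -/
noncomputable def moore (q r : ℕ) {F : Type*} [Field F] {n : ℕ} (h : Fin n → F) :
    Matrix (Fin r) (Fin n) F :=
  Matrix.of fun i j => h j ^ q ^ (i : ℕ)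

/-- A `q`-linearized polynomial of `q`-degree less than `m` which vanishes at `m` elements that are
linearly independent over the field with `q` elements is zero. -/
theorem linearized_eq_zero_of_linearIndependent {Fq F : Type*} [Field Fq] [Fintype Fq] [Field F]
    [Algebra Fq F] {m : ℕ} {g : Fin m → F} (hg : LinearIndependent Fq g) {a : Fin m → F}
    (ha : ∀ l, ∑ i, a i * g l ^ Fintype.card Fq ^ (i : ℕ) = 0) : a = 0 := by
  classical
  have hq : 1 < Fintype.card Fq := Fintype.one_lt_card
  set q := Fintype.card Fq
  rcases Nat.eq_zero_or_pos m with rfl | hm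
  · exact Subsingleton.elim _ _
  set p : Polynomial F := ∑ i : Fin m, Polynomial.monomial (q ^ (i : ℕ)) (a i) with hp
  let L : F →ₗ[Fq] F := ∑ i : Fin m,
    (LinearMap.mulLeft Fq (a i)).comp ((FiniteField.frobeniusAlgHom Fq F ^ (i : ℕ)).toLinearMap)
  have hL : ∀ x, L x = p.eval x := fun x => by
    simp [L, hp, Polynomial.eval_finsetSum, FiniteField.coe_frobeniusAlgHom,
      AlgHom.coe_pow, pow_iterate, q]
  have hp0 : p = 0 := by
    refine Polynomial.eq_zero_of_natDegree_lt_card_of_eval_eq_zero p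
      (f := fun x : Fin m → Fq => Fintype.linearCombination Fq g x) ?_ ?_ ?_
    · exact hg.fintypeLinearCombination_injective
    · intro x
      rw [← hL, Fintype.linearCombination_apply, map_sum]
      refine Finset.sum_eq_zero fun l _ => ?_
      rw [map_smul, hL]
      simp [hp, Polynomial.eval_finsetSum, ha l]
    · have : p.natDegree ≤ q ^ (m - 1) := by
        refine Polynomial.natDegree_sum_le_of_forall_le _ _ fun i _ => ?_
        exact (Polynomial.natDegree_monomial_le _).trans
          (Nat.pow_le_pow_right hq.le (by omega))
      refine this.trans_lt ?_
      rw [Fintype.card_fun, Fintype.card_fin]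
      exact Nat.pow_lt_pow_right hq (by omega)
  funext i
  have hi : p.coeff (q ^ (i : ℕ)) = a i := by
    simp [hp, Polynomial.coeff_monomial,
      Nat.pow_right_inj hq, Fin.val_inj]
  rw [← hi, hp0]
  simp

/-- The square Moore matrix of linearly independent elements has trivial kernel. -/
theorem eq_zero_of_moore_mulVec_eq_zero {Fq F : Type*} [Field Fq] [Fintype Fq] [Field F]
    [Algebra Fq F] {m : ℕ} {g : Fin m → F} (hg : LinearIndependent Fq g) {b : Fin m → F}
    (hb : (moore (Fintype.card Fq) m g).mulVec b = 0) : b = 0 := by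
  refine Matrix.eq_zero_of_mulVec_eq_zero (fun hdet => ?_) hb
  obtain ⟨v, hv, hv0⟩ := Matrix.exists_vecMul_eq_zero_iff.mpr hdet
  refine hv (linearized_eq_zero_of_linearIndependent hg fun l => ?_)
  simpa [Matrix.vecMul, dotProduct, moore] using congrFun hv0 l

/-- A nonzero vector in the kernel of the `t × n` Moore matrix of linearly independent elements
has rank norm greater than `t`. -/
theorem lt_rankq_of_moore_mulVec_eq_zero {Fq F : Type*} [Field Fq] [Fintype Fq] [Field F]
    [Algebra Fq F] {n t : ℕ} {h : Fin n → F} (hh : LinearIndependent Fq h) {c : Fin n → F}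
    (hc : c ≠ 0) (hker : (moore (Fintype.card Fq) t h).mulVec c = 0) : t < rankq Fq c := by
  by_contra! hle
  unfold rankq at hle
  set S := Submodule.span Fq (Set.range c) with hS
  have : FiniteDimensional Fq S := FiniteDimensional.span_of_finite Fq (Set.finite_range c)
  let B := Module.finBasis Fq S
  let d : Fin n → S := fun j => ⟨c j, Submodule.subset_span ⟨j, rfl⟩⟩
  have hd : ∀ j, ∑ l, B.repr (d j) l • (B l : F) = c j := fun j => by
    simpa only [Submodule.coe_subtype, map_sum, map_smul] using
      congrArg S.subtype (B.sum_repr (d j))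
  let g : Fin (Module.finrank Fq S) → F := fun l => ∑ j, B.repr (d j) l • h j
  have hg : LinearIndependent Fq g := by
    rw [Fintype.linearIndependent_iff]
    intro μ hμ
    have h1 : ∀ j, ∑ l, μ l * B.repr (d j) l = 0 := by
      refine Fintype.linearIndependent_iff.mp hh _ ?_
      rw [← hμ]
      simp only [g, Finset.smul_sum, Finset.sum_smul, smul_smul]
      exact Finset.sum_comm
    have h2 : (B.constr Fq μ : S →ₗ[Fq] Fq) = 0 := by
      refine LinearMap.ext_on_range (v := d) ?_ fun j => ?_
      · have hmap : (Submodule.span Fq (Set.range d)).map S.subtype =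
            (⊤ : Submodule Fq S).map S.subtype := by
          rw [Submodule.map_span, ← Set.range_comp, Submodule.map_subtype_top]
          rfl
        exact Submodule.map_injective_of_injective S.injective_subtype hmap
      · rw [Module.Basis.constr_apply_fintype (S := Fq)]
        simpa [mul_comm] using h1 j
    intro l
    simpa using congrArg (fun f : S →ₗ[Fq] Fq => f (B l)) h2
  have hB : (fun l => (B l : F)) = 0 := by
    refine eq_zero_of_moore_mulVec_eq_zero hg (funext fun i => ?_)
    have hi := congrFun hker ⟨i, i.2.trans_le hle⟩
    simp only [moore, Matrix.mulVec, dotProduct, Matrix.of_apply, Pi.zero_apply] at hi ⊢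
    rw [← hi]
    have hfrob : ∀ x : F, x ^ Fintype.card Fq ^ (i : ℕ) =
        (FiniteField.frobeniusAlgHom Fq F ^ (i : ℕ)) x := fun x => by
      simp [FiniteField.coe_frobeniusAlgHom, AlgHom.coe_pow, pow_iterate]
    simp only [hfrob, g, map_sum, map_smul, Finset.sum_mul]
    rw [Finset.sum_comm]
    refine Finset.sum_congr rfl fun j _ => ?_
    rw [← hd j, Finset.mul_sum]
    simp only [smul_mul_assoc, mul_smul_comm]
  refine hc (funext fun j => ?_)
  rw [← hd j]
  exact Finset.sum_eq_zero fun l _ => by rw [show (B l : F) = 0 from congrFun hB l, smul_zero]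

/-- A `t × n` matrix with `t < n` has a nonzero kernel vector of rank norm at most `t + 1`. -/
theorem exists_mulVec_eq_zero_rankq_le (Fq : Type*) {F : Type*} [Field Fq] [Field F]
    [Algebra Fq F] {n t : ℕ} (ht : t < n) (M : Matrix (Fin t) (Fin n) F) :
    ∃ c : Fin n → F, c ≠ 0 ∧ M.mulVec c = 0 ∧ rankq Fq c ≤ t + 1 := by
  let e : Fin (t + 1) → Fin n := Fin.castLE ht
  have he : Function.Injective e := Fin.castLE_injective ht
  let P : (Fin (t + 1) → F) →ₗ[F] (Fin n → F) := Function.ExtendByZero.linearMap F e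
  have hlt : Module.finrank F (Fin t → F) < Module.finrank F (Fin (t + 1) → F) := by simp
  obtain ⟨v, hv, hv0⟩ := Submodule.exists_mem_ne_zero_of_ne_bot
    (LinearMap.ker_ne_bot_of_finrank_lt (f := M.mulVecLin.comp P) hlt)
  refine ⟨P v, fun h0 => hv0 (funext fun i => ?_), hv, ?_⟩
  · simpa [P, he.extend_apply] using congrFun h0 (e i)
  · have hle : Submodule.span Fq (Set.range (P v)) ≤ Submodule.span Fq (Set.range v) := by
      refine Submodule.span_le.mpr ?_
      rintro _ ⟨j, rfl⟩
      by_cases hj : ∃ i, e i = j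
      · obtain ⟨i, rfl⟩ := hj
        simpa [P, he.extend_apply] using Submodule.subset_span (R := Fq) (Set.mem_range_self i)
      · simp [P, Function.extend_apply' _ _ _ hj]
    have := FiniteDimensional.span_of_finite Fq (Set.finite_range v)
    refine (Submodule.finrank_mono hle).trans ?_
    simpa [Set.finrank] using finrank_range_le_card (R := Fq) v

/-- The Moore matrices of `h` and of its `q^r`-th power, each with `r` rows, stack to the Moore
matrix of `h` with `2 * r` rows. -/
theorem moore_two_mul_mulVec_eq_zero_iff {F : Type*} [Field F] (q r : ℕ) {n : ℕ}
    (h c : Fin n → F) :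
    (moore q (2 * r) h).mulVec c = 0 ↔
      (moore q r h).mulVec c = 0 ∧ (moore q r fun j => h j ^ q ^ r).mulVec c = 0 := by
  simp only [funext_iff, moore, Matrix.mulVec, dotProduct, Matrix.of_apply, Pi.zero_apply,
    ← pow_mul, ← pow_add]
  refine ⟨fun H => ⟨fun i => H ⟨i, by omega⟩, fun i => H ⟨r + i, by omega⟩⟩, fun H i => ?_⟩
  by_cases hi : (i : ℕ) < r
  · exact H.1 ⟨i, hi⟩
  · have := H.2 ⟨i - r, by omega⟩
    rwa [show r + (i - r : ℕ) = i by omega] at this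

/-- For the PUM code based on Gabidulin codes with `m_H = 1` and rate `R > 1/2`,
the first extended row rank distance equals `2(n-k)+1`: the minimum rank norm of a
nonzero `c` with `H_0 c = 0` and `H_1 c = 0` is `2(n-k)+1`. -/
theorem pum_gabidulin_first_extended_row_rank_distance
    (Fq F : Type*) [Field Fq] [Fintype Fq] [Field F] [Algebra Fq F]
    [FiniteDimensional Fq F] (n k : ℕ) (hk : 1 ≤ k) (hkn : k < n) (hR : n < 2 * k)
    (h : Fin n → F)
    (hli : LinearIndependent Fq
      (Sum.elim h (fun j => h j ^ Fintype.card Fq ^ (n - k)) : Fin n ⊕ Fin n → F)) :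
    sInf {w : ℕ | ∃ c : Fin n → F, c ≠ 0 ∧
        (moore (Fintype.card Fq) (n - k) h).mulVec c = 0 ∧
        (moore (Fintype.card Fq) (n - k)
          (fun j => h j ^ Fintype.card Fq ^ (n - k))).mulVec c = 0 ∧
        w = rankq Fq c} = 2 * (n - k) + 1 := by
  have hh : LinearIndependent Fq h := by
    simpa [Function.comp_def] using hli.comp Sum.inl Sum.inl_injective
  refine IsLeast.csInf_eq ⟨?_, ?_⟩
  · obtain ⟨c, hc, hker, hle⟩ := exists_mulVec_eq_zero_rankq_le Fq
      (show 2 * (n - k) < n by omega) (moore (Fintype.card Fq) (2 * (n - k)) h)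
    obtain ⟨h0, h1⟩ := (moore_two_mul_mulVec_eq_zero_iff _ _ h c).mp hker
    exact ⟨c, hc, h0, h1, le_antisymm (lt_rankq_of_moore_mulVec_eq_zero hh hc hker) hle⟩
  · rintro _ ⟨c, hc, h0, h1, rfl⟩
    exact lt_rankq_of_moore_mulVec_eq_zero hh hc
      ((moore_two_mul_mulVec_eq_zero_iff _ _ h c).mpr ⟨h0, h1⟩)
end

section
/- For the PUM code based on Gabidulin codes with dual memory m_H = 1 and rate R > 1/2 (i.e., 2k > n), the slope of the extended row rank distance is at least half the optimal slope: liminf_{ℓ→∞} d^r_ℓ / ℓ ≥ (n − k + 1)/2, where d^r_ℓ is taken to be +∞ if no tuple in C^r(ℓ) exists. -/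
open Matrix

/-- The `ℓ`-th extended row rank distance (valued in `ℝ≥0∞`, with `sInf ∅ = ⊤`) of the
PUM code based on Gabidulin codes with `m_H = 1`. -/
noncomputable def drowE (Fq : Type*) {F : Type*} [Field Fq] [Fintype Fq] [Field F]
    [Algebra Fq F] {n : ℕ} (k : ℕ) (h : Fin n → F) (ℓ : ℕ) : ENNReal :=
  sInf {w : ENNReal | ∃ c : ℕ → Fin n → F, (∀ j, j < ℓ → c j ≠ 0) ∧
      (moore (Fintype.card Fq) (n - k) h).mulVec (c 0) = 0 ∧
      (∀ j, 1 ≤ j → j < ℓ →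
        (moore (Fintype.card Fq) (n - k) h).mulVec (c j) +
          (moore (Fintype.card Fq) (n - k)
            (fun j' => h j' ^ Fintype.card Fq ^ (n - k))).mulVec (c (j - 1)) = 0) ∧
      (moore (Fintype.card Fq) (n - k)
          (fun j' => h j' ^ Fintype.card Fq ^ (n - k))).mulVec (c (ℓ - 1)) = 0 ∧
      w = ((∑ j ∈ Finset.range ℓ, rankq Fq (c j) : ℕ) : ENNReal)}

open Polynomial in
/-- A nonzero linearized polynomial of `q`-degree less than `t` cannot vanish on `t` elements
that are linearly independent over the field with `q` elements. -/
theorem eq_zero_of_sum_mul_pow_card_pow_eq_zero {Fq F : Type*} [Field Fq] [Fintype Fq] [Field F]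
    [Algebra Fq F] {t : ℕ} {a : Fin t → F} (ha : LinearIndependent Fq a) {c : Fin t → F}
    (hc : ∀ l, ∑ i, c i * a l ^ Fintype.card Fq ^ (i : ℕ) = 0) : c = 0 := by
  classical
  have hq : 1 < Fintype.card Fq := Fintype.one_lt_card
  set P : F[X] := ∑ i : Fin t, C (c i) * X ^ Fintype.card Fq ^ (i : ℕ) with hP
  have hfrob : ∀ (i : ℕ) (x : F),
      (FiniteField.frobeniusAlgHom Fq F ^ i) x = x ^ Fintype.card Fq ^ i := by
    intro i x
    simp [AlgHom.coe_pow, FiniteField.coe_frobeniusAlgHom, pow_iterate]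
  have hP0 : P = 0 := by
    rcases Nat.eq_zero_or_pos t with rfl | ht
    · simp [hP]
    refine Polynomial.eq_zero_of_natDegree_lt_card_of_eval_eq_zero P
      (f := fun g : Fin t → Fq => ∑ l, g l • a l) ?_ ?_ ?_
    · exact LinearIndependent.fintypeLinearCombination_injective ha
    · intro g
      simp only [hP, eval_finsetSum, eval_mul, eval_C, eval_pow, eval_X, ← hfrob, map_sum,
        map_smul, Finset.mul_sum, mul_smul_comm]
      rw [Finset.sum_comm]
      simp only [← Finset.smul_sum, hfrob, hc, smul_zero, Finset.sum_const_zero]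
    · have hdeg : P.natDegree ≤ Fintype.card Fq ^ (t - 1) :=
        natDegree_sum_le_of_forall_le _ _ fun i _ => (natDegree_C_mul_X_pow_le _ _).trans
          (Nat.pow_le_pow_right hq.le (by omega))
      refine hdeg.trans_lt ?_
      rw [Fintype.card_fun, Fintype.card_fin]
      exact Nat.pow_lt_pow_right hq (by omega)
  funext i
  have hcoeff := congrArg (fun p => coeff p (Fintype.card Fq ^ (i : ℕ))) hP0
  simpa [hP, finsetSum_coeff, coeff_C_mul, coeff_X_pow, Nat.pow_right_inj hq, Fin.val_inj]
    using hcoeff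

/-- The square Moore matrix of linearly independent elements has trivial kernel. -/
theorem eq_zero_of_sum_pow_card_pow_mul_eq_zero {Fq F : Type*} [Field Fq] [Fintype Fq] [Field F]
    [Algebra Fq F] {t : ℕ} {a : Fin t → F} (ha : LinearIndependent Fq a) {b : Fin t → F}
    (hb : ∀ i : Fin t, ∑ l, a l ^ Fintype.card Fq ^ (i : ℕ) * b l = 0) : b = 0 := by
  by_contra hb0
  let M : Matrix (Fin t) (Fin t) F := Matrix.of fun i l => a l ^ Fintype.card Fq ^ (i : ℕ)
  have hdet : M.det = 0 := Matrix.exists_mulVec_eq_zero_iff.mp ⟨b, hb0, funext hb⟩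
  obtain ⟨c, hc0, hc⟩ := Matrix.exists_vecMul_eq_zero_iff.mpr hdet
  exact hc0 (eq_zero_of_sum_mul_pow_card_pow_eq_zero ha fun l => congrFun hc l)

/-- Gabidulin codes are maximum rank distance: a nonzero vector in the kernel of an `r`-row Moore
matrix of linearly independent elements has rank norm greater than `r`. -/
theorem lt_finrank_span_of_sum_pow_mul_eq_zero {Fq F ι : Type*} [Field Fq] [Fintype Fq] [Field F]
    [Algebra Fq F] [Fintype ι] {a : ι → F} (ha : LinearIndependent Fq a) {r : ℕ} {v : ι → F}
    (hv0 : v ≠ 0) (hv : ∀ i < r, ∑ j, a j ^ Fintype.card Fq ^ i * v j = 0) :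
    r < Module.finrank Fq (Submodule.span Fq (Set.range v)) := by
  by_contra! hr
  set W := Submodule.span Fq (Set.range v) with hW
  have : FiniteDimensional Fq W := FiniteDimensional.span_of_finite Fq (Set.finite_range v)
  let b := Module.finBasis Fq W
  have hmem : ∀ j, v j ∈ W := fun j => Submodule.subset_span ⟨j, rfl⟩
  let w : ι → W := fun j => ⟨v j, hmem j⟩
  have hspan : Submodule.span Fq (Set.range w) = ⊤ := by
    have := Submodule.span_span_coe_preimage (R := Fq) (s := Set.range v)
    convert this using 2
    ext x
    simp [w, Subtype.ext_iff]
  have hfrob : ∀ (i : ℕ) (x : F),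
      (FiniteField.frobeniusAlgHom Fq F ^ i) x = x ^ Fintype.card Fq ^ i := by
    intro i x
    simp [AlgHom.coe_pow, FiniteField.coe_frobeniusAlgHom, pow_iterate]
  have hvb : ∀ j, v j = ∑ l, b.repr (w j) l • (b l : F) := by
    intro j
    have hsum := congrArg W.subtype (b.sum_repr (w j))
    rw [map_sum] at hsum
    exact hsum.symm
  have hind : LinearIndependent Fq fun l => ∑ j, b.repr (w j) l • a j := by
    rw [Fintype.linearIndependent_iff] at ha ⊢
    intro g hg
    have hzero : ∀ j, ∑ l, g l * b.repr (w j) l = 0 := by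
      refine ha _ ?_
      rw [← hg]
      simp only [Finset.smul_sum, Finset.sum_smul, mul_smul]
      exact Finset.sum_comm
    have hfun : (∑ l, g l • b.coord l : W →ₗ[Fq] Fq) = 0 := by
      refine LinearMap.ext_on_range hspan fun j => ?_
      simpa using hzero j
    intro l
    simpa [Finsupp.single_apply] using LinearMap.congr_fun hfun (b l)
  have hb0 := eq_zero_of_sum_pow_card_pow_mul_eq_zero hind (b := fun l => (b l : F)) (by
    intro i
    rw [← hv i (i.2.trans_le hr)]
    simp only [← hfrob, map_sum, map_smul, hvb, Finset.mul_sum, Finset.sum_mul, mul_smul_comm,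
      smul_mul_assoc]
    exact Finset.sum_comm)
  refine hv0 (funext fun j => ?_)
  rw [hvb j]
  exact Finset.sum_eq_zero fun l _ => by rw [show (b l : F) = 0 from congrFun hb0 l, smul_zero]

/-- A lower bound for the sum of a sequence whose consecutive terms sum to at least `d`. -/
theorem add_add_mul_le_two_mul_sum {x : ℕ → ℕ} {d : ℕ} (m : ℕ)
    (hx : ∀ j < m, d ≤ x (j + 1) + x j) :
    x 0 + x m + m * d ≤ 2 * ∑ j ∈ Finset.range (m + 1), x j := by
  induction m with
  | zero => simp; omega
  | succ m ih =>
    have h1 := ih fun j hj => hx j (by omega)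
    have h2 := hx m (by omega)
    rw [Finset.sum_range_succ, add_mul]
    omega

/-- The rank norm of a concatenation is at most the sum of the rank norms. -/
theorem finrank_span_range_sumElim_le (Fq : Type*) {F : Type*} [Field Fq] [Field F] [Algebra Fq F]
    {n : ℕ} (u v : Fin n → F) :
    Module.finrank Fq (Submodule.span Fq (Set.range (Sum.elim u v))) ≤
      rankq Fq u + rankq Fq v := by
  rw [Set.Sum.elim_range, Submodule.span_union]
  have := FiniteDimensional.span_of_finite Fq (Set.finite_range u)
  have := FiniteDimensional.span_of_finite Fq (Set.finite_range v)
  exact Submodule.finrank_add_le_finrank_add_finrank _ _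

/-- The PUM code based on Gabidulin codes with `m_H = 1` and rate `R > 1/2` has slope
at least `(n - k + 1)/2` (half the optimal slope). -/
theorem pum_gabidulin_slope_lower_bound
    (Fq F : Type*) [Field Fq] [Fintype Fq] [Field F] [Algebra Fq F]
    [FiniteDimensional Fq F] (n k : ℕ) (hk : 1 ≤ k) (hkn : k < n) (hR : n < 2 * k)
    (h : Fin n → F)
    (hli : LinearIndependent Fq
      (Sum.elim h (fun j => h j ^ Fintype.card Fq ^ (n - k)) : Fin n ⊕ Fin n → F)) :
    (((n - k + 1 : ℕ) : ENNReal)) / 2 ≤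
      Filter.liminf (fun ℓ : ℕ => drowE Fq k h ℓ / (ℓ : ENNReal)) Filter.atTop := by
  refine Filter.le_liminf_of_le (by isBoundedDefault) ?_
  filter_upwards [Filter.eventually_ge_atTop 1] with ℓ hℓ
  obtain ⟨m, rfl⟩ : ∃ m, ℓ = m + 1 := ⟨ℓ - 1, by omega⟩
  rw [ENNReal.le_div_iff_mul_le (by simp) (by simp)]
  refine le_sInf ?_
  rintro w ⟨c, hc0, hfirst, hmid, hlast, rfl⟩
  have h0 : n - k + 1 ≤ rankq Fq (c 0) :=
    lt_finrank_span_of_sum_pow_mul_eq_zero (hli.comp Sum.inl Sum.inl_injective)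
      (hc0 0 (by omega)) fun i hi => congrFun hfirst ⟨i, hi⟩
  have hstep : ∀ j < m, n - k + 1 ≤ rankq Fq (c (j + 1)) + rankq Fq (c j) := by
    intro j hj
    refine le_trans ?_ (finrank_span_range_sumElim_le Fq _ _)
    refine lt_finrank_span_of_sum_pow_mul_eq_zero hli (fun h0 => ?_) fun i hi => ?_
    · exact hc0 j (by omega) (funext fun x => congrFun h0 (Sum.inr x))
    · rw [Fintype.sum_sum_type]
      exact congrFun (hmid (j + 1) (by omega) (by omega)) ⟨i, hi⟩
  have hsum := add_add_mul_le_two_mul_sum (x := fun j => rankq Fq (c j)) m hstep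
  have hnat : (n - k + 1) * (m + 1) ≤ 2 * ∑ j ∈ Finset.range (m + 1), rankq Fq (c j) := by
    rw [mul_add, mul_comm _ m]
    omega
  rw [ENNReal.mul_comm_div, ← mul_div_assoc]
  refine ENNReal.div_le_of_le_mul' ?_
  exact_mod_cast hnat
end

section
/- For every memory-1 ((partial) unit memory) convolutional code over F = GF(q^s) whose generator submatrix G_0 has rank k, the free rank distance equals the minimum over all orders ℓ ≥ 1 of the ℓ-th extended row rank distance: d_free = min_{ℓ ≥ 1} d^r_ℓ. -/
open Matrix

/-- The free rank distance of a memory-1 convolutional code. -/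
noncomputable def dfree (Fq : Type*) {F : Type*} [Field Fq] [Field F] [Algebra Fq F]
    {k n : ℕ} (G0 G1 : Matrix (Fin k) (Fin n) F) : ℕ :=
  sInf {w : ℕ | ∃ u : ℕ → Fin k → F, (∃ N, ∀ i, N ≤ i → u i = 0) ∧
      cw G0 G1 u ≠ 0 ∧ w = ∑ᶠ j, rankq Fq (cw G0 G1 u j)}

/-- The `ℓ`-th extended row rank distance of a memory-1 convolutional code. -/
noncomputable def drow (Fq : Type*) {F : Type*} [Field Fq] [Field F] [Algebra Fq F]
    {k n : ℕ} (G0 G1 : Matrix (Fin k) (Fin n) F) (ℓ : ℕ) : ℕ :=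
  sInf {w : ℕ | ∃ u : ℕ → Fin k → F, (∀ i, i < ℓ → u i ≠ 0) ∧ (∀ i, ℓ ≤ i → u i = 0) ∧
      w = ∑ᶠ j, rankq Fq (cw G0 G1 u j)}

section RankDistance

variable {Fq F : Type*} [Field Fq] [Field F] [Algebra Fq F] {k n : ℕ}

theorem rankq_zero : rankq Fq (0 : Fin n → F) = 0 := by
  unfold rankq
  have h : Submodule.span Fq (Set.range (0 : Fin n → F)) = ⊥ := by
    rw [Submodule.span_eq_bot]
    rintro x ⟨i, rfl⟩
    rfl
  rw [h, finrank_bot]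

theorem cw_zero (G0 G1 : Matrix (Fin k) (Fin n) F) (u : ℕ → Fin k → F) :
    cw G0 G1 u 0 = u 0 ᵥ* G0 := by
  simp [cw]

theorem cw_succ (G0 G1 : Matrix (Fin k) (Fin n) F) (u : ℕ → Fin k → F) (j : ℕ) :
    cw G0 G1 u (j + 1) = u (j + 1) ᵥ* G0 + u j ᵥ* G1 := by
  simp [cw]

theorem cw_eq_zero_of_lt (G0 G1 : Matrix (Fin k) (Fin n) F) {u : ℕ → Fin k → F} {N j : ℕ}
    (hu : ∀ i, N ≤ i → u i = 0) (hj : N < j) : cw G0 G1 u j = 0 := by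
  obtain ⟨j, rfl⟩ := Nat.exists_eq_succ_of_ne_zero (Nat.ne_zero_of_lt hj)
  rw [Nat.succ_eq_add_one, cw_succ, hu _ (by omega), hu _ (by omega)]
  simp

/-- The weight of a codeword sequence is a finite sum over any range covering its support. -/
theorem finsum_rankq_cw (G0 G1 : Matrix (Fin k) (Fin n) F) {u : ℕ → Fin k → F} {N M : ℕ}
    (hu : ∀ i, N ≤ i → u i = 0) (hM : N < M) :
    ∑ᶠ j, rankq Fq (cw G0 G1 u j) = ∑ j ∈ Finset.range M, rankq Fq (cw G0 G1 u j) := by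
  apply finsum_eq_sum_of_support_subset
  intro j hj
  by_contra h
  have h' : M ≤ j := by simpa using h
  exact hj (by
    change rankq Fq (cw G0 G1 u j) = 0
    rw [cw_eq_zero_of_lt G0 G1 hu (by omega), rankq_zero])

/-- Cutting an information sequence down to its first run of nonzero blocks does not increase
the weight of the associated codeword sequence. -/
theorem exists_run_finsum_rankq_cw_le (G0 G1 : Matrix (Fin k) (Fin n) F)
    {u : ℕ → Fin k → F} {N : ℕ} (hu : ∀ i, N ≤ i → u i = 0) (hne : u ≠ 0) :
    ∃ ℓ, 1 ≤ ℓ ∧ ∃ v : ℕ → Fin k → F, (∀ i, i < ℓ → v i ≠ 0) ∧ (∀ i, ℓ ≤ i → v i = 0) ∧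
      ∑ᶠ j, rankq Fq (cw G0 G1 v j) ≤ ∑ᶠ j, rankq Fq (cw G0 G1 u j) := by
  classical
  have hstart : ∃ a, u a ≠ 0 := Function.ne_iff.mp hne
  obtain ⟨a, ha, hmin⟩ : ∃ a, u a ≠ 0 ∧ ∀ i, i < a → u i = 0 :=
    ⟨Nat.find hstart, Nat.find_spec hstart, fun i hi => not_not.mp (Nat.find_min hstart hi)⟩
  have hend : ∃ ℓ, u (a + ℓ) = 0 := ⟨N, hu _ (by omega)⟩
  obtain ⟨ℓ, hℓ, hrun⟩ : ∃ ℓ, u (a + ℓ) = 0 ∧ ∀ i, i < ℓ → u (a + i) ≠ 0 :=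
    ⟨Nat.find hend, Nat.find_spec hend, fun i hi => Nat.find_min hend hi⟩
  have hpos : 1 ≤ ℓ := by
    rcases Nat.eq_zero_or_pos ℓ with rfl | h
    · exact absurd hℓ ha
    · exact h
  have hv : ∀ i, ℓ ≤ i → (fun i => if i < ℓ then u (a + i) else 0) i = 0 :=
    fun i hi => if_neg (by omega)
  refine ⟨ℓ, hpos, fun i => if i < ℓ then u (a + i) else 0, ?_, hv, ?_⟩
  · intro i hi
    simpa [hi] using hrun i hi
  have hcw : ∀ i ∈ Finset.range (ℓ + 1),
      cw G0 G1 (fun i => if i < ℓ then u (a + i) else 0) i = cw G0 G1 u (a + i) := by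
    intro i hi
    have hi' : i < ℓ + 1 := Finset.mem_range.mp hi
    have hval : ∀ i, i < ℓ + 1 → (if i < ℓ then u (a + i) else 0) = u (a + i) := by
      intro i hi
      split_ifs with h
      · rfl
      · rw [show i = ℓ by omega, hℓ]
    rcases i with _ | i
    · rw [cw_zero, hval 0 hi', Nat.add_zero]
      rcases a with _ | a
      · rw [cw_zero]
      · rw [cw_succ, hmin a (by omega), zero_vecMul, add_zero]
    · rw [cw_succ, hval _ hi', hval i (by omega), ← Nat.add_assoc, cw_succ]
  rw [finsum_rankq_cw G0 G1 hv (Nat.lt_succ_self ℓ),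
    finsum_rankq_cw G0 G1 hu (show N < a + (ℓ + 1) + (N + 1) by omega),
    Finset.sum_range_add, Finset.sum_range_add,
    Finset.sum_congr rfl fun i hi => congrArg (rankq Fq) (hcw i hi)]
  omega

end RankDistance

/-- The free rank distance is the minimum over all orders `ℓ ≥ 1` of the `ℓ`-th
extended row rank distance. -/
theorem free_rank_distance_eq_min_extended_row_rank_distance
    (Fq F : Type*) [Field Fq] [Fintype Fq] [Field F] [Algebra Fq F]
    [FiniteDimensional Fq F] (n k : ℕ) (hk : 1 ≤ k) (hkn : k < n)
    (G0 G1 : Matrix (Fin k) (Fin n) F) (hG0 : G0.rank = k) :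
    dfree Fq G0 G1 = sInf {w : ℕ | ∃ ℓ, 1 ≤ ℓ ∧ w = drow Fq G0 G1 ℓ} := by
  have hrows : ∀ ℓ, {w : ℕ | ∃ u : ℕ → Fin k → F, (∀ i, i < ℓ → u i ≠ 0) ∧
      (∀ i, ℓ ≤ i → u i = 0) ∧ w = ∑ᶠ j, rankq Fq (cw G0 G1 u j)}.Nonempty := by
    intro ℓ
    have : Nonempty (Fin k) := ⟨⟨0, hk⟩⟩
    refine ⟨_, fun i => if i < ℓ then 1 else 0, fun i hi => ?_, fun i hi => ?_, rfl⟩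
    · simp [hi]
    · simp [Nat.not_lt.mpr hi]
  have hinj : Function.Injective G0.vecMul := by
    rw [vecMul_injective_iff, linearIndependent_iff_card_eq_finrank_span, Set.finrank,
      ← rank_eq_finrank_span_row, hG0, Fintype.card_fin]
  have hmem : ∀ ℓ, 1 ≤ ℓ → drow Fq G0 G1 ℓ ∈
      {w : ℕ | ∃ u : ℕ → Fin k → F, (∃ N, ∀ i, N ≤ i → u i = 0) ∧
        cw G0 G1 u ≠ 0 ∧ w = ∑ᶠ j, rankq Fq (cw G0 G1 u j)} := by
    intro ℓ hℓ
    obtain ⟨u, hne, hzero, hw⟩ := Nat.sInf_mem (hrows ℓ)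
    refine ⟨u, ⟨ℓ, hzero⟩, fun h => hne 0 hℓ (hinj ?_), hw⟩
    change u 0 ᵥ* G0 = 0 ᵥ* G0
    rw [← cw_zero G0 G1, h, zero_vecMul, Pi.zero_apply]
  apply le_antisymm
  · obtain ⟨ℓ, hℓ, hw⟩ := Nat.sInf_mem
      (⟨_, 1, le_rfl, rfl⟩ : {w : ℕ | ∃ ℓ, 1 ≤ ℓ ∧ w = drow Fq G0 G1 ℓ}.Nonempty)
    rw [hw]
    exact Nat.sInf_le (hmem ℓ hℓ)
  · obtain ⟨u, ⟨N, hu⟩, hne, hw⟩ := Nat.sInf_mem ⟨_, hmem 1 le_rfl⟩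
    have hu0 : u ≠ 0 := by
      rintro rfl
      exact hne (by ext j; simp [cw])
    obtain ⟨ℓ, hℓ, v, hv, hv0, hle⟩ := exists_run_finsum_rankq_cw_le (Fq := Fq) G0 G1 hu hu0
    calc sInf {w : ℕ | ∃ ℓ, 1 ≤ ℓ ∧ w = drow Fq G0 G1 ℓ} ≤ drow Fq G0 G1 ℓ :=
          Nat.sInf_le ⟨ℓ, hℓ, rfl⟩
      _ ≤ ∑ᶠ j, rankq Fq (cw G0 G1 v j) := Nat.sInf_le ⟨v, hv, hv0, rfl⟩
      _ ≤ ∑ᶠ j, rankq Fq (cw G0 G1 u j) := hle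
      _ = dfree Fq G0 G1 := hw.symm
end
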